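/- The subspace X = ℝ × {0, 1} of the Euclidean plane (two parallel lines), with the uniform structure induced by the Euclidean metric, is locally uniformly joinable but not uniformly joinable. -/

import Mathlib

/-! Basic definitions: chains, `E`-homotopy, generalized paths, and the
joinability properties of uniform spaces, following Brodskiy–Dydak–LaBuz–Mitra
and Plaut. -/

/-- A subset `A` of `X` is `E`-bounded if `A × A ⊆ E`. -/
def IsEBounded {X : Type*} (E : Set (X × X)) (A : Set X) : Prop :=
  ∀ a ∈ A, ∀ b ∈ A, (a, b) ∈ E

/-- A list of points is an `E`-chain if every pair of consecutive points
belongs to `E`. -/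
def IsEChain {X : Type*} (E : Set (X × X)) (c : List X) : Prop :=
  c.Chain' fun a b => (a, b) ∈ E

/-- `c` is an `E`-chain from `x` to `y`. -/
def IsEChainFromTo {X : Type*} (E : Set (X × X)) (c : List X) (x y : X) : Prop :=
  IsEChain E c ∧ c.head? = some x ∧ c.getLast? = some y

/-- A basic move inserts a single point `z` between two consecutive points
`a`, `b` of a chain, in such a way that `{a, z, b}` is `E`-bounded. -/
def BasicMove {X : Type*} (E : Set (X × X)) (c d : List X) : Prop :=
  ∃ (p q : List X) (a z b : X),
    IsEBounded E {a, z, b} ∧ c = p ++ a :: b :: q ∧ d = p ++ a :: z :: b :: q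

/-- Two `E`-chains are `E`-homotopic if one can be obtained from the other by a
finite sequence of basic moves (insertions or deletions); endpoints are kept
fixed automatically. -/
def EHomotopic {X : Type*} (E : Set (X × X)) : List X → List X → Prop :=
  Relation.EqvGen (BasicMove E)

/-- A generalized path from `x` to `y` in a uniform space `X`: a compatible
family of (`E`-homotopy classes of) `E`-chains from `x` to `y`, indexed by the
entourages `E` of `X`.  It is recorded by a choice of representative chain for
each entourage, such that for `F ⊆ E` the representative at `F` is
`E`-homotopic to the representative at `E` (this determines, and is determined
by, the family of homotopy classes). -/
structure GenPath {X : Type*} [UniformSpace X] (x y : X) where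
  /-- a representative `E`-chain for each entourage `E` -/
  chain : ∀ E : Set (X × X), E ∈ uniformity X → List X
  isChain : ∀ (E : Set (X × X)) (hE : E ∈ uniformity X),
    IsEChainFromTo E (chain E hE) x y
  compat : ∀ (F E : Set (X × X)) (hF : F ∈ uniformity X) (hE : E ∈ uniformity X),
    F ⊆ E → EHomotopic E (chain F hF) (chain E hE)

/-- A generalized path from `x` to `y` is `E`-short if its `E`-level homotopy
class is the class of the two-point chain `x, y`. -/
def GenPath.EShort {X : Type*} [UniformSpace X] {x y : X} (α : GenPath x y)
    (E : Set (X × X)) : Prop :=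
  ∀ hE : E ∈ uniformity X, EHomotopic E (α.chain E hE) [x, y]

/-- `X` is chain connected if for every entourage `E`, every pair of points of
`X` can be joined by an `E`-chain. -/
def ChainConnected (X : Type*) [UniformSpace X] : Prop :=
  ∀ E ∈ uniformity X, ∀ x y : X, ∃ c : List X, IsEChainFromTo E c x y

/-- `X` is uniformly joinable if every pair of points can be joined by a
generalized path. -/
def UniformlyJoinable (X : Type*) [UniformSpace X] : Prop :=
  ∀ x y : X, Nonempty (GenPath x y)

/-- `X` is locally uniformly joinable if for every entourage `E` there is an
entourage `F` such that any pair `(x, y) ∈ F` can be joined by an `E`-short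
generalized path. -/
def LocallyUniformlyJoinable (X : Type*) [UniformSpace X] : Prop :=
  ∀ E ∈ uniformity X, ∃ F ∈ uniformity X, ∀ x y : X, (x, y) ∈ F →
    ∃ α : GenPath x y, α.EShort E

/-- `X` is weakly chained if it is chain connected and for every entourage `E`
there is an entourage `F ⊆ E` such that every pair `(x, y) ∈ F` can be joined
by arbitrarily fine chains that are `E`-short (i.e. for every entourage `G`
there is a `G`-chain from `x` to `y` that is `E`-homotopic to the two-point
chain `x, y`). -/
def WeaklyChained (X : Type*) [UniformSpace X] : Prop :=
  ChainConnected X ∧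
    ∀ E ∈ uniformity X, ∃ F ∈ uniformity X, F ⊆ E ∧
      ∀ x y : X, (x, y) ∈ F → ∀ G ∈ uniformity X,
        ∃ c : List X, IsEChainFromTo G c x y ∧ EHomotopic E c [x, y]

/-- Two parallel lines in the Euclidean plane. -/
def ParallelLines : Set (EuclideanSpace ℝ (Fin 2)) :=
  {p | p 1 = 0 ∨ p 1 = 1}

section Homotopy

variable {X : Type*} {E F : Set (X × X)}

theorem isEChain_iff_isChain {c : List X} : IsEChain E c ↔ c.IsChain fun a b => (a, b) ∈ E :=
  Iff.rfl

/-- `E`-homotopy is compatible with concatenation on both sides. -/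
theorem EHomotopic.append_append {c d : List X} (h : EHomotopic E c d) (p q : List X) :
    EHomotopic E (p ++ c ++ q) (p ++ d ++ q) := by
  induction h with
  | rel c d h =>
    obtain ⟨p', q', a, z, b, hb, rfl, rfl⟩ := h
    exact .rel _ _ ⟨p ++ p', q' ++ q, a, z, b, hb, by simp, by simp⟩
  | refl c => exact .refl _
  | symm c d _ ih => exact .symm _ _ ih
  | trans c d e _ _ ih₁ ih₂ => exact .trans _ _ _ ih₁ ih₂

/-- The images under `γ` of the interior points of the subdivision of the interval from `s` to `t`
into `2 ^ k` equal parts. -/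
noncomputable def dyadicInterior (γ : ℝ → X) : ℕ → ℝ → ℝ → List X
  | 0, _, _ => []
  | k + 1, s, t => dyadicInterior γ k s ((s + t) / 2) ++
      γ ((s + t) / 2) :: dyadicInterior γ k ((s + t) / 2) t

theorem dyadicInterior_succ (γ : ℝ → X) (k : ℕ) (s t : ℝ) :
    dyadicInterior γ (k + 1) s t = dyadicInterior γ k s ((s + t) / 2) ++
      γ ((s + t) / 2) :: dyadicInterior γ k ((s + t) / 2) t :=
  rfl

/-- The images under `γ` of the points of the subdivision of the interval from `s` to `t` into
`2 ^ k` equal parts. -/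
noncomputable def dyadicChain (γ : ℝ → X) (k : ℕ) (s t : ℝ) : List X :=
  γ s :: (dyadicInterior γ k s t ++ [γ t])

/-- `γ` maps pairs of reals at distance at most `r` into `E`. -/
def IsFine (γ : ℝ → X) (E : Set (X × X)) (r : ℝ) : Prop :=
  ∀ u v : ℝ, |u - v| ≤ r → (γ u, γ v) ∈ E

theorem IsFine.mono {γ : ℝ → X} {r r' : ℝ} (h : IsFine γ F r) (hFE : F ⊆ E) (hr : r' ≤ r) :
    IsFine γ E r' :=
  fun u v huv => hFE (h u v (huv.trans hr))

theorem abs_sub_midpoint_le {s t r : ℝ} (h : |s - t| ≤ 2 * r) :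
    |s - (s + t) / 2| ≤ r ∧ |(s + t) / 2 - t| ≤ r := by
  rw [abs_le] at h
  constructor <;> rw [abs_le] <;> constructor <;> linarith

theorem IsFine.isEChain_dyadicChain {γ : ℝ → X} {r : ℝ} (h : IsFine γ E r) (k : ℕ) {s t : ℝ}
    (hst : |s - t| ≤ 2 ^ k * r) : IsEChain E (dyadicChain γ k s t) := by
  induction k generalizing s t with
  | zero => simpa [isEChain_iff_isChain, dyadicChain, dyadicInterior] using h s t (by simpa using hst)
  | succ k ih =>
    obtain ⟨h₁, h₂⟩ := abs_sub_midpoint_le (r := 2 ^ k * r) (hst.trans_eq (by ring))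
    have key := (List.isChain_split (l₁ := γ s :: dyadicInterior γ k s ((s + t) / 2))).2
      ⟨isEChain_iff_isChain.1 (ih h₁), isEChain_iff_isChain.1 (ih h₂)⟩
    simpa [isEChain_iff_isChain, dyadicChain, dyadicInterior] using key

theorem IsFine.eHomotopic_dyadicChain_succ {γ : ℝ → X} {r : ℝ} (h : IsFine γ E r) (k : ℕ)
    {s t : ℝ} (hst : |s - t| ≤ 2 ^ k * r) :
    EHomotopic E (dyadicChain γ k s t) (dyadicChain γ (k + 1) s t) := by
  induction k generalizing s t with
  | zero =>
    have hst' : |s - t| ≤ r := by simpa using hst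
    have hr : 0 ≤ r := (abs_nonneg _).trans hst'
    obtain ⟨h₁, h₂⟩ := abs_sub_midpoint_le (r := r) (hst'.trans (by linarith))
    refine .rel _ _ ⟨[], [], γ s, γ ((s + t) / 2), γ t, ?_, by simp [dyadicChain, dyadicInterior],
      by simp [dyadicChain, dyadicInterior]⟩
    rintro a (rfl | rfl | rfl) b (rfl | rfl | rfl) <;> apply h <;>
      first
        | assumption
        | (rw [abs_sub_comm]; assumption)
        | simpa using hr
  | succ k ih =>
    obtain ⟨h₁, h₂⟩ := abs_sub_midpoint_le (r := 2 ^ k * r) (hst.trans_eq (by ring))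
    have left := (ih h₁).append_append [] (dyadicInterior γ k ((s + t) / 2) t ++ [γ t])
    have right := (ih h₂).append_append (γ s :: dyadicInterior γ (k + 1) s ((s + t) / 2)) []
    simp only [dyadicChain, List.nil_append, List.append_nil, List.cons_append,
      List.append_assoc] at left right
    rw [dyadicChain, dyadicChain, dyadicInterior_succ γ k, dyadicInterior_succ γ (k + 1)]
    simp only [List.cons_append, List.append_assoc]
    exact .trans _ _ _ left right

theorem IsFine.eHomotopic_dyadicChain_of_le {γ : ℝ → X} {k l : ℕ} (h : IsFine γ E (1 / 2 ^ k))
    (hkl : k ≤ l) : EHomotopic E (dyadicChain γ k 0 1) (dyadicChain γ l 0 1) := by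
  induction l, hkl using Nat.le_induction with
  | base => exact .refl _
  | succ l hkl ih =>
    have hl : IsFine γ E (1 / 2 ^ l) := h.mono subset_rfl (by gcongr; norm_num)
    exact .trans _ _ _ ih (hl.eHomotopic_dyadicChain_succ l (by simp))

theorem IsFine.eHomotopic_dyadicChain {γ : ℝ → X} {k l : ℕ} (hk : IsFine γ E (1 / 2 ^ k))
    (hl : IsFine γ E (1 / 2 ^ l)) : EHomotopic E (dyadicChain γ k 0 1) (dyadicChain γ l 0 1) := by
  rcases le_total k l with h | h
  · exact hk.eHomotopic_dyadicChain_of_le h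
  · exact .symm _ _ (hl.eHomotopic_dyadicChain_of_le h)

end Homotopy

theorem UniformContinuous.exists_isFine {X : Type*} [UniformSpace X] {γ : ℝ → X}
    (hγ : UniformContinuous γ) {E : Set (X × X)} (hE : E ∈ uniformity X) :
    ∃ k : ℕ, IsFine γ E (1 / 2 ^ k) := by
  obtain ⟨δ, hδ, h⟩ := Metric.mem_uniformity_dist.1 (hγ hE)
  obtain ⟨k, hk⟩ := exists_pow_lt_of_lt_one hδ (by norm_num : (1 / 2 : ℝ) < 1)
  rw [one_div_pow] at hk
  exact ⟨k, fun u v huv => h (huv.trans_lt hk)⟩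

/-- A uniformly continuous curve `γ` induces a generalized path from `γ 0` to `γ 1`. -/
noncomputable def UniformContinuous.genPath {X : Type*} [UniformSpace X] {γ : ℝ → X}
    (hγ : UniformContinuous γ) : GenPath (γ 0) (γ 1) where
  chain _ hE := dyadicChain γ (hγ.exists_isFine hE).choose 0 1
  isChain _ hE := ⟨(hγ.exists_isFine hE).choose_spec.isEChain_dyadicChain _ (by simp),
    by simp [dyadicChain], by simp [dyadicChain, List.getLast?_cons]⟩
  compat _ _ hF hE hFE :=
    ((hγ.exists_isFine hF).choose_spec.mono hFE le_rfl).eHomotopic_dyadicChain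
      (hγ.exists_isFine hE).choose_spec

theorem UniformContinuous.genPath_eShort {X : Type*} [UniformSpace X] {γ : ℝ → X}
    (hγ : UniformContinuous γ) {E : Set (X × X)} (h : IsFine γ E 1) : hγ.genPath.EShort E :=
  fun hE => (hγ.exists_isFine hE).choose_spec.eHomotopic_dyadicChain (l := 0) (by simpa using h)

namespace ParallelLines

theorem abs_coord_sub_le_dist (p q : ParallelLines) (i : Fin 2) :
    |p.1 i - q.1 i| ≤ dist p q := by
  simpa [Subtype.dist_eq, dist_eq_norm] using PiLp.norm_apply_le (p.1 - q.1) i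

theorem coord_one_eq_of_dist_lt_one {p q : ParallelLines} (h : dist p q < 1) :
    p.1 1 = q.1 1 := by
  have hlt := (abs_coord_sub_le_dist p q 1).trans_lt h
  rcases p.2 with hp | hp <;> rcases q.2 with hq | hq <;> rw [hp, hq] at hlt ⊢ <;> norm_num at hlt

/-- The affine parametrization of the line through `p`, sending `0` to `p` and `1` to the point of
that line with first coordinate `b`. -/
noncomputable def line (p : ParallelLines) (b : ℝ) (t : ℝ) : ParallelLines :=
  ⟨!₂[p.1 0 + t * (b - p.1 0), p.1 1], by simpa [ParallelLines] using p.2⟩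

theorem dist_line (p : ParallelLines) (b u v : ℝ) :
    dist (line p b u) (line p b v) = |b - p.1 0| * |u - v| := by
  rw [Subtype.dist_eq, EuclideanSpace.dist_eq, ← abs_mul, ← Real.sqrt_sq_eq_abs]
  simp only [line, Fin.sum_univ_two, Real.dist_eq, sq_abs]
  congr 1
  simp
  ring

theorem uniformContinuous_line (p : ParallelLines) (b : ℝ) : UniformContinuous (line p b) :=
  (LipschitzWith.of_dist_le_mul (K := ‖b - p.1 0‖₊) fun u v => by
    simp [dist_line, Real.dist_eq]).uniformContinuous

theorem line_zero (p : ParallelLines) (b : ℝ) : line p b 0 = p := by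
  ext i
  fin_cases i <;> simp [line]

theorem line_one {p q : ParallelLines} (h : p.1 1 = q.1 1) : line p (q.1 0) 1 = q := by
  ext i
  fin_cases i <;> simp [line, h]

theorem locallyUniformlyJoinable : LocallyUniformlyJoinable ParallelLines := by
  intro E hE
  obtain ⟨ε, hε, hεE⟩ := Metric.mem_uniformity_dist.1 hE
  refine ⟨_, Metric.dist_mem_uniformity (lt_min hε one_pos), fun p q hpq => ?_⟩
  obtain ⟨hdε, hd⟩ := lt_min_iff.1 (show dist p q < min ε 1 from hpq)
  have hfine : IsFine (line p (q.1 0)) E 1 := fun u v huv => hεE <| by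
    have hle := abs_coord_sub_le_dist p q 0
    rw [abs_sub_comm] at hle
    calc dist (line p (q.1 0) u) (line p (q.1 0) v) = |q.1 0 - p.1 0| * |u - v| := dist_line ..
      _ ≤ |q.1 0 - p.1 0| := mul_le_of_le_one_right (abs_nonneg _) huv
      _ < ε := hle.trans_lt hdε
  have key : ∃ α : GenPath (line p (q.1 0) 0) (line p (q.1 0) 1), α.EShort E :=
    ⟨_, (uniformContinuous_line p (q.1 0)).genPath_eShort hfine⟩
  rwa [line_zero, line_one (coord_one_eq_of_dist_lt_one hd)] at key

theorem coord_one_eq_of_isEChainFromTo {c : List ParallelLines} {p q : ParallelLines}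
    (h : IsEChainFromTo {r | dist r.1 r.2 < 1} c p q) : p.1 1 = q.1 1 := by
  obtain ⟨hc, hp, hq⟩ := h
  induction c generalizing p with
  | nil => simp at hp
  | cons a c ih =>
    obtain rfl : a = p := by simpa using hp
    cases c with
    | nil => simp_all
    | cons b c =>
      obtain ⟨hab, hbc⟩ := List.isChain_cons_cons.1 hc
      exact (coord_one_eq_of_dist_lt_one hab).trans (ih hbc rfl (by simpa using hq))

theorem not_uniformlyJoinable : ¬ UniformlyJoinable ParallelLines := by
  intro h
  obtain ⟨α⟩ := h ⟨!₂[0, 0], by simp [ParallelLines]⟩ ⟨!₂[0, 1], by simp [ParallelLines]⟩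
  simpa using coord_one_eq_of_isEChainFromTo (α.isChain _ (Metric.dist_mem_uniformity one_pos))

end ParallelLines

/-- The subspace `ℝ × {0, 1}` of the plane (two parallel lines), with the
uniform structure induced by the Euclidean metric, is locally uniformly
joinable but not uniformly joinable. -/
theorem parallelLines_locallyUniformlyJoinable_not_uniformlyJoinable :
    LocallyUniformlyJoinable ↥ParallelLines ∧ ¬ UniformlyJoinable ↥ParallelLines :=
  ⟨ParallelLines.locallyUniformlyJoinable, ParallelLines.not_uniformlyJoinable⟩
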